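/- arXiv:2405.11851 — 2 statements merged into one kernel-verified Lean document; each statement's English description precedes it below -/
import Mathlib

section
/- (Growth bound for the GFBM covariance kernel.) Let δ be any number with (α−γ)₊/(1−α) < δ < (1/2 − γ/2)/(1−α). Then there exists a constant c > 0 such that for all u ∈ (0, 1] and all v > 0: R(u, v) ≤ c ( u^{α} v^{α} + u · v^{(1−α)δ + α} + 1 ), where R(u, v) = ∫₀^{u∧v} (u−x)^{α} (v−x)^{α} x^{−γ} dx + ∫₀^{∞} ((u+x)^{α} − x^{α})((v+x)^{α} − x^{α}) x^{−γ} dx. -/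
open MeasureTheory Real Set

/-- The covariance kernel `R(u,v)` of the generalized fractional Brownian motion:
`R(u,v) = ∫₀^{u∧v} (u−x)^α (v−x)^α x^{−γ} dx
  + ∫₀^∞ ((u+x)^α − x^α)((v+x)^α − x^α) x^{−γ} dx`. -/
noncomputable def gfbmR (α γ u v : ℝ) : ℝ :=
  (∫ x in Set.Ioc 0 (min u v), (u - x) ^ α * (v - x) ^ α * x ^ (-γ)) +
  ∫ x in Set.Ioi (0:ℝ), ((u + x) ^ α - x ^ α) * ((v + x) ^ α - x ^ α) * x ^ (-γ)

lemma integrableOn_Ioc_rpow {a m : ℝ} (ha : -1 < a) (hm : 0 ≤ m) :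
    IntegrableOn (fun x : ℝ => x ^ a) (Ioc 0 m) := by
  rw [← intervalIntegrable_iff_integrableOn_Ioc_of_le hm]
  exact intervalIntegral.intervalIntegrable_rpow' ha

lemma integral_Ioc_rpow {a m : ℝ} (ha : -1 < a) (hm : 0 ≤ m) :
    ∫ x in Ioc 0 m, x ^ a = m ^ (a + 1) / (a + 1) := by
  rw [← intervalIntegral.integral_of_le hm, integral_rpow (Or.inl ha),
    zero_rpow (by linarith), sub_zero]

/-- A function on `(0, ∞)` dominated by powers near `0` and near `∞` has explicitly bounded
integral. -/
lemma integral_Ioi_le_of_le_rpow {f : ℝ → ℝ} {A B a b : ℝ} (ha : -1 < a) (hb : b < -1)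
    (hf : ∀ x, 0 < x → 0 ≤ f x) (hA : ∀ x, 0 < x → x ≤ 1 → f x ≤ A * x ^ a)
    (hB : ∀ x, 1 < x → f x ≤ B * x ^ b) :
    ∫ x in Ioi (0 : ℝ), f x ≤ A / (a + 1) + B / (-b - 1) := by
  have h1 : IntegrableOn (fun x : ℝ => A * x ^ a) (Ioc 0 1) :=
    (integrableOn_Ioc_rpow ha zero_le_one).const_mul A
  have h2 : IntegrableOn (fun x : ℝ => B * x ^ b) (Ioi 1) :=
    (integrableOn_Ioi_rpow_of_lt hb zero_lt_one).const_mul B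
  set g : ℝ → ℝ := fun x => if x ≤ 1 then A * x ^ a else B * x ^ b with hg
  have e1 : EqOn (fun x : ℝ => A * x ^ a) g (Ioc 0 1) := fun x hx => by simp [hg, hx.2]
  have e2 : EqOn (fun x : ℝ => B * x ^ b) g (Ioi 1) := fun x hx => by
    simp [hg, not_le.mpr (mem_Ioi.mp hx)]
  have g1 : IntegrableOn g (Ioc 0 1) := h1.congr_fun e1 measurableSet_Ioc
  have g2 : IntegrableOn g (Ioi 1) := h2.congr_fun e2 measurableSet_Ioi
  have hU : Ioc (0 : ℝ) 1 ∪ Ioi 1 = Ioi 0 := Ioc_union_Ioi_eq_Ioi zero_le_one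
  have hgi : IntegrableOn g (Ioi 0) := hU ▸ g1.union g2
  calc ∫ x in Ioi (0 : ℝ), f x ≤ ∫ x in Ioi (0 : ℝ), g x := by
        refine integral_mono_of_nonneg ?_ hgi ?_
        · exact (ae_restrict_iff' measurableSet_Ioi).mpr (.of_forall fun x hx => hf x hx)
        · refine (ae_restrict_iff' measurableSet_Ioi).mpr (.of_forall fun x hx => ?_)
          by_cases h : x ≤ 1
          · simpa [hg, h] using hA x hx h
          · simpa [hg, h] using hB x (not_le.mp h)
    _ = A / (a + 1) + B / (-b - 1) := by
        rw [← hU, setIntegral_union (Ioc_disjoint_Ioi le_rfl) measurableSet_Ioi g1 g2,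
          ← setIntegral_congr_fun measurableSet_Ioc e1,
          ← setIntegral_congr_fun measurableSet_Ioi e2, integral_const_mul, integral_const_mul,
          integral_Ioc_rpow ha zero_le_one, integral_Ioi_rpow_of_lt hb zero_lt_one,
          one_rpow, one_rpow]
        have : -b - 1 ≠ 0 := by linarith
        have : b + 1 ≠ 0 := by linarith
        field_simp
        ring

lemma rpow_sub_add_rpow_le_mul {α u x : ℝ} (hα : -1 ≤ α) (hu : 0 ≤ u) (hx : 0 < x) :
    x ^ α - (u + x) ^ α ≤ u * x ^ (α - 1) := by
  have hs : 0 ≤ u / x := by positivity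
  have e : (u + x) ^ α = x ^ α * (1 + u / x) ^ α := by
    rw [← mul_rpow hx.le (by positivity)]
    congr 1
    field_simp
    ring
  have h1 : 1 - u / x ≤ (1 + u / x) ^ α := by
    calc 1 - u / x ≤ (1 + u / x)⁻¹ := by
          rw [← one_div, le_div_iff₀ (by positivity)]
          nlinarith
      _ = (1 + u / x) ^ (-1 : ℝ) := (rpow_neg_one _).symm
      _ ≤ (1 + u / x) ^ α := rpow_le_rpow_of_exponent_le (by linarith) hα
  have h2 : u * x ^ (α - 1) = x ^ α * (u / x) := by
    rw [rpow_sub_one hx.ne']; ring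
  rw [e, h2]
  nlinarith [rpow_nonneg hx.le α]

lemma add_rpow_sub_rpow_le_mul {α u x : ℝ} (hα : 0 ≤ α) (hα1 : α ≤ 1) (hu : 0 ≤ u) (hx : 0 < x) :
    (u + x) ^ α - x ^ α ≤ u * x ^ (α - 1) := by
  have hs : 0 ≤ u / x := by positivity
  have e : (u + x) ^ α = x ^ α * (1 + u / x) ^ α := by
    rw [← mul_rpow hx.le (by positivity)]
    congr 1
    field_simp
    ring
  have h1 : (1 + u / x) ^ α ≤ 1 + u / x :=
    (rpow_one_add_le_one_add_mul_self (by linarith) hα hα1).trans (by nlinarith)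
  have h2 : u * x ^ (α - 1) = x ^ α * (u / x) := by
    rw [rpow_sub_one hx.ne']; ring
  rw [e, h2]
  nlinarith [rpow_nonneg hx.le α]

lemma add_rpow_sub_rpow_le_rpow {α u x : ℝ} (hα : 0 ≤ α) (hα1 : α ≤ 1) (hu : 0 ≤ u)
    (hx : 0 ≤ x) : (u + x) ^ α - x ^ α ≤ u ^ α := by
  linarith [rpow_add_le_add_rpow hu hx hα hα1]

/-- Interpolation between the bounds `v ^ α` and `v * x ^ (α - 1)` of the increment. -/
lemma add_rpow_sub_rpow_le_interpolate {α δ v x : ℝ} (hα : 0 ≤ α) (hα1 : α ≤ 1) (hδ : 0 < δ)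
    (hδ1 : δ < 1) (hv : 0 < v) (hx : 0 < x) :
    (v + x) ^ α - x ^ α ≤ v ^ ((1 - α) * δ + α) * x ^ (-((1 - α) * δ)) := by
  set D := (v + x) ^ α - x ^ α
  have hD : 0 ≤ D := sub_nonneg.mpr (rpow_le_rpow hx.le (by linarith) hα)
  calc D = D ^ (1 - δ) * D ^ δ := by
        rw [← rpow_add' hD (by simp)]; simp
    _ ≤ (v ^ α) ^ (1 - δ) * (v * x ^ (α - 1)) ^ δ := by
        gcongr
        · exact add_rpow_sub_rpow_le_rpow hα hα1 hv.le hx.le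
        · exact add_rpow_sub_rpow_le_mul hα hα1 hv.le hx
    _ = _ := by
        rw [mul_rpow hv.le (by positivity), ← rpow_mul hv.le, ← rpow_mul hx.le, ← mul_assoc,
          ← rpow_add hv]
        congr 2 <;> ring

lemma integral_increments_le_of_nonneg {α γ δ u v : ℝ} (hα : 0 ≤ α) (hα1 : α ≤ 1) (hγ : γ < 1)
    (hδ : 0 < δ) (hδ1 : δ < 1) (hdec : α - γ < (1 - α) * δ) (hu : 0 < u) (hv : 0 < v) :
    ∫ x in Ioi (0 : ℝ), ((u + x) ^ α - x ^ α) * ((v + x) ^ α - x ^ α) * x ^ (-γ) ≤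
      u ^ α * v ^ α / (-γ + 1) +
        u * v ^ ((1 - α) * δ + α) / (-(α - 1 - (1 - α) * δ - γ) - 1) := by
  have hnn : ∀ w x : ℝ, 0 < w → 0 < x → 0 ≤ (w + x) ^ α - x ^ α := fun w x hw hx =>
    sub_nonneg.mpr (rpow_le_rpow hx.le (by linarith) hα)
  refine integral_Ioi_le_of_le_rpow (by linarith) (by linarith) (fun x hx => ?_)
    (fun x hx _ => ?_) (fun x hx1 => ?_)
  · have := hnn u x hu hx
    have := hnn v x hv hx
    positivity
  · gcongr
    · exact hnn v x hv hx
    · exact add_rpow_sub_rpow_le_rpow hα hα1 hu.le hx.le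
    · exact add_rpow_sub_rpow_le_rpow hα hα1 hv.le hx.le
  · have hx : 0 < x := by linarith
    calc _ ≤ (u * x ^ (α - 1)) * (v ^ ((1 - α) * δ + α) * x ^ (-((1 - α) * δ))) * x ^ (-γ) := by
          gcongr
          · exact hnn v x hv hx
          · exact add_rpow_sub_rpow_le_mul hα hα1 hu.le hx
          · exact add_rpow_sub_rpow_le_interpolate hα hα1 hδ hδ1 hv hx
      _ = u * v ^ ((1 - α) * δ + α) * (x ^ (α - 1) * x ^ (-((1 - α) * δ)) * x ^ (-γ)) := by ring
      _ = _ := by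
          rw [← rpow_add hx, ← rpow_add hx]
          ring_nf

lemma integral_increments_le_of_neg {α γ u v : ℝ} (hα : α < 0) (hαγ : -1 < 2 * α - γ)
    (hγ : 0 ≤ γ) (hu : 0 < u) (hu1 : u ≤ 1) (hv : 0 < v) :
    ∫ x in Ioi (0 : ℝ), ((u + x) ^ α - x ^ α) * ((v + x) ^ α - x ^ α) * x ^ (-γ) ≤
      1 / (2 * α - γ + 1) + 1 / (-(2 * α - 1 - γ) - 1) := by
  have hnn : ∀ w x : ℝ, 0 < w → 0 < x → 0 ≤ x ^ α - (w + x) ^ α := fun w x hw hx =>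
    sub_nonneg.mpr (rpow_le_rpow_of_nonpos hx (by linarith) hα.le)
  have hle : ∀ w x : ℝ, 0 < w → 0 < x → x ^ α - (w + x) ^ α ≤ x ^ α := fun w x hw hx =>
    sub_le_self _ (by positivity)
  have hsign : ∀ x : ℝ, ((u + x) ^ α - x ^ α) * ((v + x) ^ α - x ^ α) * x ^ (-γ) =
      (x ^ α - (u + x) ^ α) * (x ^ α - (v + x) ^ α) * x ^ (-γ) := fun x => by ring
  simp only [hsign]
  refine integral_Ioi_le_of_le_rpow hαγ (by linarith) (fun x hx => ?_)
    (fun x hx _ => ?_) (fun x hx1 => ?_)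
  · have := hnn u x hu hx
    have := hnn v x hv hx
    positivity
  · calc _ ≤ x ^ α * x ^ α * x ^ (-γ) := by
          gcongr
          · exact hnn v x hv hx
          · exact hle u x hu hx
          · exact hle v x hv hx
      _ = _ := by
          rw [← rpow_add hx, ← rpow_add hx, one_mul]
          congr 1; ring
  · have hx : 0 < x := by linarith
    calc _ ≤ (1 * x ^ (α - 1)) * x ^ α * x ^ (-γ) := by
          gcongr
          · exact hnn v x hv hx
          · exact (rpow_sub_add_rpow_le_mul (by linarith) hu.le hx).trans (by gcongr)
          · exact hle v x hv hx
      _ = _ := by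
          rw [one_mul, ← rpow_add hx, ← rpow_add hx, one_mul]
          congr 1; ring

lemma integral_overlap_le_of_nonneg {α γ u v : ℝ} (hα : 0 ≤ α) (hγ : γ < 1) (hu : 0 < u)
    (hu1 : u ≤ 1) (hv : 0 < v) :
    ∫ x in Ioc 0 (min u v), (u - x) ^ α * (v - x) ^ α * x ^ (-γ) ≤
      u ^ α * v ^ α * (1 / (-γ + 1)) := by
  have hm : 0 < min u v := lt_min hu hv
  have hm1 : min u v ≤ 1 := (min_le_left _ _).trans hu1
  calc _ ≤ ∫ x in Ioc 0 (min u v), u ^ α * v ^ α * x ^ (-γ) := by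
        refine integral_mono_of_nonneg ?_
          ((integrableOn_Ioc_rpow (by linarith) hm.le).const_mul _) ?_
        all_goals
          refine (ae_restrict_iff' measurableSet_Ioc).mpr (.of_forall fun x hx => ?_)
          have hx0 : 0 < x := hx.1
          have hxu : 0 ≤ u - x := sub_nonneg.mpr (hx.2.trans (min_le_left _ _))
          have hxv : 0 ≤ v - x := sub_nonneg.mpr (hx.2.trans (min_le_right _ _))
          dsimp
        · positivity
        · gcongr <;> linarith
    _ = u ^ α * v ^ α * (min u v ^ (-γ + 1) / (-γ + 1)) := by
        rw [integral_const_mul, integral_Ioc_rpow (by linarith) hm.le]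
    _ ≤ _ := by
        have : 0 < -γ + 1 := by linarith
        gcongr
        exact rpow_le_one hm.le hm1 this.le

/-- A bound for the incomplete Beta-type integral obtained by splitting at the midpoint. -/
lemma integral_overlap_le_of_neg {α γ u v : ℝ} (hα : α < 0) (hαγ : -1 < 2 * α - γ)
    (hγ0 : 0 ≤ γ) (hu : 0 < u) (hu1 : u ≤ 1) (hv : 0 < v) :
    ∫ x in Ioc 0 (min u v), (u - x) ^ α * (v - x) ^ α * x ^ (-γ) ≤
      (1 / 2) ^ (2 * α) / (-γ + 1) + (1 / 2) ^ (-γ) / (2 * α + 1) := by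
  set m := min u v
  have hm : 0 < m := lt_min hu hv
  have hm1 : m ≤ 1 := (min_le_left _ _).trans hu1
  have h2α : -1 < 2 * α := by linarith
  have i1 : IntegrableOn (fun x : ℝ => (m / 2) ^ (2 * α) * x ^ (-γ)) (Ioc 0 m) :=
    (integrableOn_Ioc_rpow (by linarith) hm.le).const_mul _
  have i2' : IntervalIntegrable (fun x : ℝ => (m - x) ^ (2 * α)) volume 0 m := by
    simpa using ((intervalIntegral.intervalIntegrable_rpow' (a := 0) (b := m) h2α).comp_sub_left
      m).symm
  have i2 : IntegrableOn (fun x : ℝ => (m / 2) ^ (-γ) * (m - x) ^ (2 * α)) (Ioc 0 m) :=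
    ((intervalIntegrable_iff_integrableOn_Ioc_of_le hm.le).mp i2').const_mul _
  have e2 : ∫ x in Ioc 0 m, (m - x) ^ (2 * α) = m ^ (2 * α + 1) / (2 * α + 1) := by
    rw [← intervalIntegral.integral_of_le hm.le,
      intervalIntegral.integral_comp_sub_left (fun x => x ^ (2 * α)), sub_self, sub_zero,
      intervalIntegral.integral_of_le hm.le, integral_Ioc_rpow h2α hm.le]
  have bound : ∀ x ∈ Ioo 0 m, (u - x) ^ α * (v - x) ^ α * x ^ (-γ) ≤
      (m / 2) ^ (2 * α) * x ^ (-γ) + (m / 2) ^ (-γ) * (m - x) ^ (2 * α) := by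
    intro x hx
    have hx0 : 0 < x := hx.1
    have hmx : 0 < m - x := sub_pos.mpr hx.2
    have hmu : m ≤ u := min_le_left _ _
    have hmv : m ≤ v := min_le_right _ _
    have h1 : (u - x) ^ α * (v - x) ^ α * x ^ (-γ) ≤ (m - x) ^ (2 * α) * x ^ (-γ) := by
      have : (m - x) ^ (2 * α) = (m - x) ^ α * (m - x) ^ α := by
        rw [← rpow_add hmx]; ring_nf
      have hvx : 0 < v - x := by linarith
      have hpu : (u - x) ^ α ≤ (m - x) ^ α := rpow_le_rpow_of_nonpos hmx (by linarith) hα.le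
      have hpv : (v - x) ^ α ≤ (m - x) ^ α := rpow_le_rpow_of_nonpos hmx (by linarith) hα.le
      rw [this]
      exact mul_le_mul_of_nonneg_right (mul_le_mul hpu hpv (by positivity) (by positivity))
        (by positivity)
    refine h1.trans ?_
    rcases le_total x (m / 2) with h | h
    · have : (m - x) ^ (2 * α) ≤ (m / 2) ^ (2 * α) :=
        rpow_le_rpow_of_nonpos (by linarith) (by linarith) (by linarith)
      have h3 : 0 ≤ (m / 2) ^ (-γ) * (m - x) ^ (2 * α) := by positivity
      have h4 : 0 ≤ x ^ (-γ) := by positivity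
      nlinarith
    · have : x ^ (-γ) ≤ (m / 2) ^ (-γ) :=
        rpow_le_rpow_of_nonpos (by linarith) (by linarith) (by linarith)
      have h3 : 0 ≤ (m / 2) ^ (2 * α) * x ^ (-γ) := by positivity
      have h4 : 0 ≤ (m - x) ^ (2 * α) := by positivity
      nlinarith
  have scale : ∀ a b : ℝ, 0 ≤ a + b → 0 < b →
      (m / 2) ^ a * (m ^ b / b) ≤ (1 / 2) ^ a / b := by
    intro a b hab hb
    have : (m / 2) ^ a * (m ^ b / b) = (1 / 2) ^ a / b * m ^ (a + b) := by
      rw [rpow_add hm, div_eq_mul_one_div m 2, mul_rpow hm.le (by norm_num)]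
      ring
    rw [this]
    exact mul_le_of_le_one_right (by positivity) (rpow_le_one hm.le hm1 hab)
  calc _ ≤ ∫ x in Ioc 0 m,
          ((m / 2) ^ (2 * α) * x ^ (-γ) + (m / 2) ^ (-γ) * (m - x) ^ (2 * α)) := by
        rw [integral_Ioc_eq_integral_Ioo, integral_Ioc_eq_integral_Ioo]
        refine integral_mono_of_nonneg ?_ ((i1.add i2).mono_set Ioo_subset_Ioc_self) ?_
        · refine (ae_restrict_iff' measurableSet_Ioo).mpr (.of_forall fun x hx => ?_)
          have hx0 : 0 < x := hx.1
          have hxu : 0 ≤ u - x := sub_nonneg.mpr (hx.2.le.trans (min_le_left _ _))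
          have hxv : 0 ≤ v - x := sub_nonneg.mpr (hx.2.le.trans (min_le_right _ _))
          dsimp
          positivity
        · exact (ae_restrict_iff' measurableSet_Ioo).mpr (.of_forall bound)
    _ = (m / 2) ^ (2 * α) * (m ^ (-γ + 1) / (-γ + 1)) +
          (m / 2) ^ (-γ) * (m ^ (2 * α + 1) / (2 * α + 1)) := by
        rw [integral_add i1 i2, integral_const_mul, integral_const_mul,
          integral_Ioc_rpow (by linarith) hm.le, e2]
    _ ≤ _ := add_le_add (scale _ _ (by linarith) (by linarith))
        (scale _ _ (by linarith) (by linarith))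

/-- Growth bound for the GFBM covariance kernel:
`R(u,v) ≤ c (u^α v^α + u v^{(1−α)δ+α} + 1)` for `u ∈ (0,1]` and `v > 0`. -/
theorem gfbmR_growth_bound
    (γ α : ℝ) (hγ : γ ∈ Set.Ico (0:ℝ) 1)
    (hα : α ∈ Set.Ioo (-1/2 + γ/2) (1/2))
    (δ : ℝ) (hδl : max (α - γ) 0 / (1 - α) < δ) (hδu : δ < (1/2 - γ/2) / (1 - α)) :
    ∃ c : ℝ, 0 < c ∧ ∀ u v : ℝ, 0 < u → u ≤ 1 → 0 < v →
      gfbmR α γ u v ≤ c * (u ^ α * v ^ α + u * v ^ ((1 - α) * δ + α) + 1) := by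
  obtain ⟨hγ0, hγ1⟩ := hγ
  obtain ⟨hαl, hαu⟩ := hα
  have h1α : 0 < 1 - α := by linarith
  rw [div_lt_iff₀ h1α] at hδl
  rw [lt_div_iff₀ h1α] at hδu
  have hγ' : 0 < -γ + 1 := by linarith
  have hdec : α - γ < (1 - α) * δ := by linarith [le_max_left (α - γ) 0]
  have hκ : 0 < δ * (1 - α) := (le_max_right _ _).trans_lt hδl
  have hδ : 0 < δ := pos_of_mul_pos_left hκ h1α.le
  have hδ1 : δ < 1 := by nlinarith
  rcases le_or_gt 0 α with hα0 | hα0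
  · set p := -(α - 1 - (1 - α) * δ - γ) - 1 with hp
    have hp0 : 0 < p := by rw [hp]; linarith
    refine ⟨2 * (1 / (-γ + 1)) + 1 / p, by positivity, fun u v hu hu1 hv => ?_⟩
    have t1 := integral_overlap_le_of_nonneg hα0 hγ1 hu hu1 hv
    have t2 := integral_increments_le_of_nonneg hα0 (by linarith) hγ1 hδ hδ1 hdec hu hv
    rw [← hp, div_eq_mul_one_div, div_eq_mul_one_div (u * _) p] at t2
    have hX : 0 ≤ u ^ α * v ^ α := by positivity
    have hY : 0 ≤ u * v ^ ((1 - α) * δ + α) := by positivity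
    have hA : 0 < 1 / (-γ + 1) := by positivity
    have hB : 0 < 1 / p := by positivity
    unfold gfbmR
    generalize u ^ α * v ^ α = X at *
    generalize u * v ^ ((1 - α) * δ + α) = Y at *
    generalize 1 / (-γ + 1) = A at *
    generalize 1 / p = B at *
    nlinarith [mul_nonneg hX hB.le, mul_nonneg hY hA.le]
  · have q1 : 0 < 2 * α - γ + 1 := by linarith
    have q2 : 0 < -(2 * α - 1 - γ) - 1 := by linarith
    have q3 : 0 < 2 * α + 1 := by linarith
    set C := ((1 / 2) ^ (2 * α) / (-γ + 1) + (1 / 2) ^ (-γ) / (2 * α + 1)) +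
      (1 / (2 * α - γ + 1) + 1 / (-(2 * α - 1 - γ) - 1)) with hC
    have hC0 : 0 < C := by positivity
    refine ⟨C, hC0, fun u v hu hu1 hv => ?_⟩
    have t1 := integral_overlap_le_of_neg hα0 (by linarith) hγ0 hu hu1 hv
    have t2 := integral_increments_le_of_neg hα0 (by linarith) hγ0 hu hu1 hv
    have hX : 0 ≤ u ^ α * v ^ α + u * v ^ ((1 - α) * δ + α) := by positivity
    calc gfbmR α γ u v ≤ C := add_le_add t1 t2
      _ ≤ _ := le_mul_of_one_le_right hC0.le (by linarith)
end

section
/- (Pointwise increment bound for power functions.) Let α and ρ be real numbers with 0 < ρ ≤ 1 and α ≤ ρ. Then for all real x, s, w with x < s and w ≥ 0: |(s + w − x)^{α} − (s − x)^{α}| ≤ (|α|/ρ) (s − x)^{α − ρ} w^{ρ}. -/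
open Real

/-- Among power functions, increments over `[a, b]` with exponent `α` are controlled by those with
a larger exponent `ρ`. -/
lemma abs_rpow_sub_rpow_le {α ρ a b : ℝ} (hρ : 0 < ρ) (hαρ : α ≤ ρ) (ha : 0 < a) (hab : a ≤ b) :
    |b ^ α - a ^ α| ≤ |α| / ρ * a ^ (α - ρ) * (b ^ ρ - a ^ ρ) := by
  rcases hab.eq_or_lt with rfl | hab
  · simp
  have hderiv (p : ℝ) {y : ℝ} (hy : 0 < y) :
      HasDerivAt (fun y : ℝ => y ^ p) (p * y ^ (p - 1)) y :=
    hasDerivAt_rpow_const (Or.inl hy.ne')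
  have hcont (p : ℝ) : ContinuousOn (fun y : ℝ => y ^ p) (Set.Icc a b) := fun y hy =>
    (hderiv p (ha.trans_le hy.1)).continuousAt.continuousWithinAt
  obtain ⟨c, hc, h⟩ := exists_ratio_hasDerivAt_eq_ratio_slope (fun y : ℝ => y ^ α)
    (fun y => α * y ^ (α - 1)) hab (hcont α) (fun y hy => hderiv α (ha.trans hy.1))
    (fun y : ℝ => y ^ ρ) (fun y => ρ * y ^ (ρ - 1)) (hcont ρ)
    (fun y hy => hderiv ρ (ha.trans hy.1))
  have hc0 : 0 < c := ha.trans hc.1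
  have hpow : c ^ (α - 1) = c ^ (α - ρ) * c ^ (ρ - 1) := by
    rw [← rpow_add hc0]
    ring_nf
  have hinc : 0 ≤ b ^ ρ - a ^ ρ := sub_nonneg.2 (rpow_le_rpow ha.le hab.le hρ.le)
  have heq : b ^ α - a ^ α = α / ρ * c ^ (α - ρ) * (b ^ ρ - a ^ ρ) := by
    have hcρ : c ^ (ρ - 1) ≠ 0 := (rpow_pos_of_pos hc0 _).ne'
    simp only [hpow] at h
    field_simp
    apply mul_right_cancel₀ hcρ
    linarith
  rw [heq, abs_mul, abs_mul, abs_div, abs_of_pos hρ, abs_of_nonneg hinc,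
    abs_of_pos (rpow_pos_of_pos hc0 _)]
  gcongr ?_ * _
  gcongr _ * ?_
  exact rpow_le_rpow_of_nonpos ha hc.1.le (sub_nonpos.2 hαρ)

/-- Pointwise increment bound for power functions:
`|(s+w−x)^α − (s−x)^α| ≤ (|α|/ρ) (s−x)^{α−ρ} w^ρ` for `0 < ρ ≤ 1`, `α ≤ ρ`,
`x < s` and `w ≥ 0`. -/
theorem rpow_increment_bound
    (α ρ : ℝ) (hρ : 0 < ρ) (hρ1 : ρ ≤ 1) (hαρ : α ≤ ρ)
    (x s w : ℝ) (hxs : x < s) (hw : 0 ≤ w) :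
    |(s + w - x) ^ α - (s - x) ^ α| ≤ (|α| / ρ) * (s - x) ^ (α - ρ) * w ^ ρ := by
  have ha : 0 < s - x := sub_pos.2 hxs
  rw [add_sub_right_comm]
  refine (abs_rpow_sub_rpow_le hρ hαρ ha (le_add_of_nonneg_right hw)).trans ?_
  gcongr
  rw [sub_le_iff_le_add']
  exact rpow_add_le_add_rpow ha.le hw hρ.le hρ1
end
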